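/- Let n ≥ 1, s ∈ ℝ, 1 ≤ p, q ≤ ∞, and g, φ ∈ 𝒮(ℝⁿ) with g ≠ 0. Then there exists a constant C > 0 such that for every finitely supported sequence {c_ℓ}_{ℓ∈ℤⁿ} of complex numbers, setting f(t) = Σ_{ℓ∈ℤⁿ} c_ℓ φ(t − ℓ), one has ‖ ‖⟨x⟩^s V_g f(x,ξ)‖_{L^q(ℝⁿ, dx)} ‖_{L^p(ℝⁿ, dξ)} ≤ C (Σ_{ℓ∈ℤⁿ} ⟨ℓ⟩^{sq} |c_ℓ|^q)^{1/q} (with the usual modification when q = ∞). -/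

import Mathlib

open MeasureTheory Real
open scoped ENNReal RealInnerProductSpace

noncomputable section

/-- The short-time Fourier transform
`V_g f (x, ξ) = ∫ e^{-i ξ·t} conj (g (t - x)) f t dt`. -/
def STFT {n : ℕ} (g f : EuclideanSpace ℝ (Fin n) → ℂ)
    (x ξ : EuclideanSpace ℝ (Fin n)) : ℂ :=
  ∫ t : EuclideanSpace ℝ (Fin n),
    Complex.exp (-(Complex.I * Complex.ofReal ⟪ξ, t⟫)) * (starRingEnd ℂ) (g (t - x)) * f t

/-- The Fourier transform `f̂ (ξ) = ∫ e^{-i ξ·x} f x dx`. -/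
def FT {n : ℕ} (f : EuclideanSpace ℝ (Fin n) → ℂ) (ξ : EuclideanSpace ℝ (Fin n)) : ℂ :=
  ∫ x : EuclideanSpace ℝ (Fin n),
    Complex.exp (-(Complex.I * Complex.ofReal ⟪ξ, x⟫)) * f x

/-- The power of the Japanese bracket `⟨x⟩ˢ = (1 + |x|²)^(s/2)`. -/
def jp {n : ℕ} (s : ℝ) (x : EuclideanSpace ℝ (Fin n)) : ℝ := (1 + ‖x‖ ^ 2) ^ (s / 2)

/-- The Gaussian window `g₀ (t) = e^{-|t|²}`. -/
def gauss {n : ℕ} (t : EuclideanSpace ℝ (Fin n)) : ℂ := Complex.ofReal (Real.exp (-‖t‖ ^ 2))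

/-- The `L^p` norm (valued in `ℝ≥0∞`) of an `ℝ≥0∞`-valued function. -/
def lpN {n : ℕ} (p : ℝ≥0∞) (F : EuclideanSpace ℝ (Fin n) → ℝ≥0∞) : ℝ≥0∞ :=
  if p = ∞ then essSup F volume
  else (∫⁻ x, F x ^ p.toReal) ^ p.toReal⁻¹

/-- The Wiener amalgam space norm `‖f‖_{W^s_{p,q}}`:
inner `L^q` norm in the frequency variable ξ, outer `L^p` norm in the space variable x,
with the Gaussian window. -/
def WNorm {n : ℕ} (s : ℝ) (p q : ℝ≥0∞) (f : EuclideanSpace ℝ (Fin n) → ℂ) : ℝ≥0∞ :=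
  lpN p (fun x => lpN q (fun ξ => ENNReal.ofReal (jp s ξ) * (‖STFT gauss f x ξ‖₊ : ℝ≥0∞)))

/-- The modulation space norm `‖f‖_{M^s_{p,q}}`:
inner `L^p` norm in the space variable x, outer `L^q` norm in the frequency variable ξ,
with the Gaussian window. -/
def MNorm {n : ℕ} (s : ℝ) (p q : ℝ≥0∞) (f : EuclideanSpace ℝ (Fin n) → ℂ) : ℝ≥0∞ :=
  lpN q (fun ξ => lpN p (fun x => ENNReal.ofReal (jp s ξ) * (‖STFT gauss f x ξ‖₊ : ℝ≥0∞)))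

/-- The Schrödinger operator `e^{iεΔ} f = ℱ⁻¹ [ξ ↦ e^{-iε|ξ|²} f̂ (ξ)]` (`ε = ±1`). -/
def schrod {n : ℕ} (ε : ℝ) (f : EuclideanSpace ℝ (Fin n) → ℂ)
    (x : EuclideanSpace ℝ (Fin n)) : ℂ :=
  (((2 * Real.pi) ^ n)⁻¹ : ℝ) *
    ∫ ξ : EuclideanSpace ℝ (Fin n),
      Complex.exp (Complex.I * Complex.ofReal ⟪x, ξ⟫) *
        Complex.exp (-(Complex.ofReal ε * Complex.I * Complex.ofReal (‖ξ‖ ^ 2))) * FT f ξ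

/-- The lattice point `k ∈ ℤⁿ` viewed as a point of `ℝⁿ`. -/
def zlift {n : ℕ} (k : Fin n → ℤ) : EuclideanSpace ℝ (Fin n) :=
  (WithLp.equiv 2 (Fin n → ℝ)).symm fun i => (k i : ℝ)


section helpers

variable {n : ℕ}

lemma jp_pos (s : ℝ) (x : EuclideanSpace ℝ (Fin n)) : 0 < jp s x := by
  unfold jp; positivity

lemma jp_add (a b : ℝ) (x : EuclideanSpace ℝ (Fin n)) : jp (a + b) x = jp a x * jp b x := by
  unfold jp
  rw [← Real.rpow_add (by positivity), add_div]

lemma jp_neg (s : ℝ) (x : EuclideanSpace ℝ (Fin n)) : jp s (-x) = jp s x := by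
  simp [jp]

lemma jp_mono {a b : ℝ} (h : a ≤ b) (x : EuclideanSpace ℝ (Fin n)) : jp a x ≤ jp b x := by
  unfold jp
  exact Real.rpow_le_rpow_of_exponent_le (by nlinarith [sq_nonneg ‖x‖]) (by linarith)

lemma jp_le_one {a : ℝ} (h : a ≤ 0) (x : EuclideanSpace ℝ (Fin n)) : jp a x ≤ 1 := by
  have := jp_mono h x
  simpa [jp] using this

lemma continuous_jp (s : ℝ) : Continuous (jp s : EuclideanSpace ℝ (Fin n) → ℝ) := by
  unfold jp
  exact Continuous.rpow_const (by fun_prop) fun x => Or.inl (by positivity)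

lemma one_add_norm_sq_le (x y : EuclideanSpace ℝ (Fin n)) :
    1 + ‖x‖ ^ 2 ≤ 2 * ((1 + ‖y‖ ^ 2) * (1 + ‖x - y‖ ^ 2)) := by
  have h : ‖x‖ ≤ ‖y‖ + ‖x - y‖ := by
    simpa using norm_add_le y (x - y)
  have h2 : ‖x‖ ^ 2 ≤ (‖y‖ + ‖x - y‖) ^ 2 := by gcongr
  nlinarith [sq_nonneg (‖y‖ - ‖x - y‖), mul_nonneg (sq_nonneg ‖y‖) (sq_nonneg ‖x - y‖)]

/-- **Peetre's inequality**. -/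
lemma jp_le_mul_jp_sub (s : ℝ) (x y : EuclideanSpace ℝ (Fin n)) :
    jp s x ≤ 2 ^ (|s| / 2) * (jp s y * jp |s| (x - y)) := by
  have key : ∀ r : ℝ, 0 ≤ r → ∀ x y : EuclideanSpace ℝ (Fin n),
      jp r x ≤ 2 ^ (r / 2) * (jp r y * jp r (x - y)) := by
    intro r hr x y
    unfold jp
    rw [← Real.mul_rpow (by positivity) (by positivity),
      ← Real.mul_rpow (by positivity) (by positivity)]
    exact Real.rpow_le_rpow (by positivity) (one_add_norm_sq_le x y) (by positivity)
  rcases le_or_gt 0 s with hs | hs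
  · rw [abs_of_nonneg hs]
    exact key s hs x y
  · rw [abs_of_neg hs]
    have h := key (-s) (by linarith) y x
    have hx : jp s x * jp (-s) x = 1 := by rw [← jp_add]; simp [jp]
    have hy : jp s y * jp (-s) y = 1 := by rw [← jp_add]; simp [jp]
    rw [← neg_sub x y, jp_neg] at h
    calc jp s x = jp s x * jp s y * jp (-s) y := by rw [mul_assoc, hy, mul_one]
      _ ≤ jp s x * jp s y * (2 ^ (-s / 2) * (jp (-s) x * jp (-s) (x - y))) :=
        mul_le_mul_of_nonneg_left h (mul_pos (jp_pos _ _) (jp_pos _ _)).le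
      _ = (jp s x * jp (-s) x) * (2 ^ (-s / 2) * (jp s y * jp (-s) (x - y))) := by ring
      _ = _ := by rw [hx, one_mul]

lemma integrable_jp {r : ℝ} (hr : (n : ℝ) < r) :
    Integrable (jp (-r) : EuclideanSpace ℝ (Fin n) → ℝ) :=
  integrable_rpow_neg_one_add_norm_sq (by simpa using hr)

lemma jp_natCast_le (N : ℕ) (x : EuclideanSpace ℝ (Fin n)) : jp N x ≤ (1 + ‖x‖) ^ N := by
  have h : 1 + ‖x‖ ^ 2 ≤ (1 + ‖x‖) ^ 2 := by nlinarith [norm_nonneg x]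
  calc jp N x ≤ ((1 + ‖x‖) ^ 2) ^ ((N : ℝ) / 2) :=
        Real.rpow_le_rpow (by positivity) h (by positivity)
    _ = (1 + ‖x‖) ^ N := by
        rw [← Real.rpow_natCast_mul (by positivity), ← Real.rpow_natCast]
        congr 1
        push_cast
        ring

lemma exists_norm_le_jp (f : SchwartzMap (EuclideanSpace ℝ (Fin n)) ℂ) (N : ℕ) :
    ∃ C : ℝ, 0 < C ∧ ∀ x, ‖f x‖ ≤ C * jp (-N) x := by
  refine ⟨2 ^ N * (Finset.Iic (N, 0)).sup (fun m => SchwartzMap.seminorm ℝ m.1 m.2) f + 1,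
    by positivity, fun x => ?_⟩
  have h := SchwartzMap.one_add_le_sup_seminorm_apply (𝕜 := ℝ) (m := (N, 0)) (le_refl N)
    (le_refl 0) f x
  rw [norm_iteratedFDeriv_zero] at h
  have h1 : jp (-N) x * jp N x = 1 := by rw [← jp_add]; simp [jp]
  have h2 : jp N x * ‖f x‖ ≤
      2 ^ N * (Finset.Iic (N, 0)).sup (fun m => SchwartzMap.seminorm ℝ m.1 m.2) f + 1 :=
    ((mul_le_mul_of_nonneg_right (jp_natCast_le N x) (norm_nonneg _)).trans h).trans (by simp)
  calc ‖f x‖ = jp (-N) x * (jp N x * ‖f x‖) := by rw [← mul_assoc, h1, one_mul]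
    _ ≤ jp (-N) x * _ := mul_le_mul_of_nonneg_left h2 (jp_pos _ _).le
    _ = _ := mul_comm _ _

lemma exists_integral_norm_mul_norm_le (f h : SchwartzMap (EuclideanSpace ℝ (Fin n)) ℂ) (N : ℕ) :
    ∃ C : ℝ, 0 < C ∧ ∀ z, ∫ t, ‖f (t - z)‖ * ‖h t‖ ≤ C * jp (-N) z := by
  obtain ⟨A, hA, hf⟩ := exists_norm_le_jp f N
  obtain ⟨B, hB, hh⟩ := exists_norm_le_jp h (N + (n + 1))
  have hint : Integrable (jp (-((n : ℝ) + 1)) : EuclideanSpace ℝ (Fin n) → ℝ) :=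
    integrable_jp (by linarith)
  have hI : 0 ≤ ∫ t : EuclideanSpace ℝ (Fin n), jp (-((n : ℝ) + 1)) t :=
    integral_nonneg fun t => (jp_pos _ t).le
  refine ⟨A * B * 2 ^ ((N : ℝ) / 2) * (∫ t : EuclideanSpace ℝ (Fin n), jp (-((n : ℝ) + 1)) t) + 1,
    by positivity, fun z => ?_⟩
  have hb : ∀ t, ‖f (t - z)‖ * ‖h t‖ ≤
      A * B * 2 ^ ((N : ℝ) / 2) * jp (-N) z * jp (-((n : ℝ) + 1)) t := by
    intro t
    have h1 := jp_le_mul_jp_sub (-(N : ℝ)) (t - z) (-z)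
    rw [abs_neg, Nat.abs_cast, jp_neg, sub_neg_eq_add, sub_add_cancel] at h1
    have h2 : jp (-((N + (n + 1) : ℕ) : ℝ)) t = jp (-N) t * jp (-((n : ℝ) + 1)) t := by
      rw [← jp_add]; congr 1; push_cast; ring
    have h3 : jp N t * jp (-N) t = 1 := by rw [← jp_add]; simp [jp]
    calc ‖f (t - z)‖ * ‖h t‖
        ≤ (A * (2 ^ ((N : ℝ) / 2) * (jp (-N) z * jp N t))) *
          (B * (jp (-N) t * jp (-((n : ℝ) + 1)) t)) := by
          have := jp_pos (N : ℝ) t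
          have := jp_pos (-N : ℝ) z
          refine mul_le_mul ((hf _).trans ?_) ((hh t).trans_eq (by rw [h2])) (norm_nonneg _)
            (by positivity)
          exact mul_le_mul_of_nonneg_left h1 hA.le
      _ = A * B * 2 ^ ((N : ℝ) / 2) * jp (-N) z * jp (-((n : ℝ) + 1)) t * (jp N t * jp (-N) t) := by
          ring
      _ = _ := by rw [h3, mul_one]
  calc ∫ t, ‖f (t - z)‖ * ‖h t‖
      ≤ ∫ t, A * B * 2 ^ ((N : ℝ) / 2) * jp (-N) z * jp (-((n : ℝ) + 1)) t :=
        integral_mono_of_nonneg (.of_forall fun t => by positivity) (hint.const_mul _)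
          (.of_forall hb)
    _ = (A * B * 2 ^ ((N : ℝ) / 2) * ∫ t : EuclideanSpace ℝ (Fin n), jp (-((n : ℝ) + 1)) t)
          * jp (-N) z := by rw [integral_const_mul]; ring
    _ ≤ _ := mul_le_mul_of_nonneg_right (by linarith) (jp_pos _ _).le

lemma norm_STFT_le (g φ : EuclideanSpace ℝ (Fin n) → ℂ) (x ξ : EuclideanSpace ℝ (Fin n)) :
    ‖STFT g φ x ξ‖ ≤ ∫ t, ‖g (t - x)‖ * ‖φ t‖ := by
  refine (norm_integral_le_integral_norm _).trans_eq (integral_congr_ae (.of_forall fun t => ?_))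
  simp [Complex.norm_exp]

lemma integrable_STFT (g φ : SchwartzMap (EuclideanSpace ℝ (Fin n)) ℂ)
    (x ξ : EuclideanSpace ℝ (Fin n)) :
    Integrable fun t => Complex.exp (-(Complex.I * Complex.ofReal ⟪ξ, t⟫)) *
      (starRingEnd ℂ) (g (t - x)) * φ t := by
  obtain ⟨A, hA, hf⟩ := exists_norm_le_jp g 0
  refine φ.integrable.bdd_mul (c := A) (Continuous.aestronglyMeasurable ?_) (.of_forall fun t => ?_)
  · have := g.continuous
    fun_prop
  · simpa [Complex.norm_exp, jp] using hf (t - x)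

lemma jp_inv_two_pi_smul_le (N : ℕ) (ξ : EuclideanSpace ℝ (Fin n)) :
    jp (-N) ((2 * π)⁻¹ • ξ) ≤ (2 * π) ^ N * jp (-N) ξ := by
  have hpi := Real.pi_gt_three
  have h : 1 + ‖ξ‖ ^ 2 ≤ (2 * π) ^ 2 * (1 + ‖(2 * π)⁻¹ • ξ‖ ^ 2) := by
    have h0 : (2 * π) * ((2 * π)⁻¹ * ‖ξ‖) = ‖ξ‖ := mul_inv_cancel_left₀ (by positivity) _
    rw [norm_smul, Real.norm_of_nonneg (by positivity), mul_add, ← mul_pow, h0]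
    nlinarith
  have h1 : jp N ξ ≤ (2 * π) ^ N * jp N ((2 * π)⁻¹ • ξ) := by
    unfold jp
    refine (Real.rpow_le_rpow (by positivity) h (by positivity)).trans_eq ?_
    rw [Real.mul_rpow (by positivity) (by positivity), ← Real.rpow_natCast_mul (by positivity),
      ← Real.rpow_natCast (2 * π) N]
    congr 2
    push_cast
    ring
  have hx : jp (-N) ξ * jp N ξ = 1 := by rw [← jp_add]; simp [jp]
  have hy : jp (-N) ((2 * π)⁻¹ • ξ) * jp N ((2 * π)⁻¹ • ξ) = 1 := by rw [← jp_add]; simp [jp]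
  set y := (2 * π)⁻¹ • ξ
  calc jp (-N) y = jp (-N) y * jp (-N) ξ * jp N ξ := by rw [mul_assoc, hx, mul_one]
    _ ≤ jp (-N) y * jp (-N) ξ * ((2 * π) ^ N * jp N y) :=
      mul_le_mul_of_nonneg_left h1 (mul_pos (jp_pos _ _) (jp_pos _ _)).le
    _ = (2 * π) ^ N * jp (-N) ξ * (jp (-N) y * jp N y) := by ring
    _ = _ := by rw [hy, mul_one]

open FourierTransform in
lemma norm_fourier_conj_translate (g : EuclideanSpace ℝ (Fin n) → ℂ)
    (x ξ u : EuclideanSpace ℝ (Fin n)) :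
    ‖𝓕 (fun t => Complex.exp (-(Complex.I * Complex.ofReal ⟪ξ, t⟫)) *
      (starRingEnd ℂ) (g (t - x))) u‖ = ‖𝓕 g (-u - (2 * π)⁻¹ • ξ)‖ := by
  rw [Real.fourier_eq', Real.fourier_eq', ← Complex.norm_conj, ← integral_conj,
    ← integral_add_right_eq_self _ x]
  have hpi : (π : ℂ) ≠ 0 := by exact_mod_cast Real.pi_ne_zero
  have : ∀ t : EuclideanSpace ℝ (Fin n), (starRingEnd ℂ)
      (Complex.exp ((↑(-2 * π * ⟪t + x, u⟫) * Complex.I)) •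
        (Complex.exp (-(Complex.I * Complex.ofReal ⟪ξ, t + x⟫)) *
          (starRingEnd ℂ) (g (t + x - x)))) =
      Complex.exp (↑(2 * π * ⟪x, u⟫ + ⟪ξ, x⟫) * Complex.I) *
        (Complex.exp ((↑(-2 * π * ⟪t, -u - (2 * π)⁻¹ • ξ⟫) * Complex.I)) • g t) := by
    intro t
    simp only [smul_eq_mul, map_mul, ← Complex.exp_conj, Complex.conj_conj, add_sub_cancel_right, ← mul_assoc, ← Complex.exp_add]
    congr 2
    simp only [map_add, map_neg, map_mul, Complex.conj_I, Complex.conj_ofReal, inner_add_left, inner_add_right, inner_sub_right, inner_neg_right,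
      inner_smul_right, real_inner_comm ξ t]
    push_cast
    field_simp
    ring
  simp_rw [this]
  rw [integral_const_mul, norm_mul, Complex.norm_exp_ofReal_mul_I, one_mul]

open FourierTransform in
lemma exists_norm_STFT_le_frequency (g φ : SchwartzMap (EuclideanSpace ℝ (Fin n)) ℂ) (N : ℕ) :
    ∃ C : ℝ, 0 < C ∧ ∀ x ξ, ‖STFT g φ x ξ‖ ≤ C * jp (-N) ξ := by
  obtain ⟨C, hC, h⟩ := exists_integral_norm_mul_norm_le (𝓕 g) (𝓕 φ) N
  refine ⟨C * (2 * π) ^ N, by positivity, fun x ξ => ?_⟩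
  have hint : Integrable (fun t => Complex.exp (-(Complex.I * Complex.ofReal ⟪ξ, t⟫)) *
      (starRingEnd ℂ) (g (t - x))) := by
    refine ((g.integrable (μ := volume)).comp_sub_right x).norm.mono'
      (Continuous.aestronglyMeasurable ?_) (.of_forall fun t => ?_)
    · have := g.continuous
      fun_prop
    · simp [Complex.norm_exp]
  have hflip := VectorFourier.integral_fourierIntegral_smul_eq_flip
    (L := innerₗ (EuclideanSpace ℝ (Fin n))) Real.continuous_fourierChar continuous_inner hint
    ((𝓕⁻ φ).integrable (μ := volume))
  rw [flip_innerₗ] at hflip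
  have hφ : ∀ t, VectorFourier.fourierIntegral 𝐞 volume (innerₗ (EuclideanSpace ℝ (Fin n)))
      ⇑(𝓕⁻ φ : SchwartzMap (EuclideanSpace ℝ (Fin n)) ℂ) t = φ t := fun t => by
    change (𝓕 (𝓕⁻ φ) : SchwartzMap (EuclideanSpace ℝ (Fin n)) ℂ) t = φ t
    rw [FourierTransform.fourier_fourierInv_eq]
  simp_rw [hφ, smul_eq_mul] at hflip
  unfold STFT
  rw [← hflip]
  calc _ ≤ ∫ u, ‖(𝓕 g) (-u - (2 * π)⁻¹ • ξ)‖ * ‖(𝓕 φ) (-u)‖ := by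
        refine (norm_integral_le_integral_norm _).trans_eq
          (integral_congr_ae (.of_forall fun u => ?_))
        simp only [norm_mul]
        rw [SchwartzMap.fourierInv_coe, Real.fourierInv_eq_fourier_neg]
        congr 1
        exact norm_fourier_conj_translate g x ξ u
    _ = ∫ u, ‖(𝓕 g) (u - (2 * π)⁻¹ • ξ)‖ * ‖(𝓕 φ) u‖ :=
        integral_neg_eq_self (fun u => ‖(𝓕 g) (u - (2 * π)⁻¹ • ξ)‖ * ‖(𝓕 φ) u‖) volume
    _ ≤ C * jp (-N) ((2 * π)⁻¹ • ξ) := h _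
    _ ≤ C * ((2 * π) ^ N * jp (-N) ξ) :=
        mul_le_mul_of_nonneg_left (jp_inv_two_pi_smul_le N ξ) hC.le
    _ = _ := by ring

lemma exists_norm_STFT_le (g φ : SchwartzMap (EuclideanSpace ℝ (Fin n)) ℂ) (N : ℕ) :
    ∃ C : ℝ, 0 < C ∧ ∀ x ξ, ‖STFT g φ x ξ‖ ≤ C * (jp (-N) x * jp (-N) ξ) := by
  obtain ⟨A, hA, h1⟩ := exists_integral_norm_mul_norm_le g φ (2 * N)
  obtain ⟨B, hB, h2⟩ := exists_norm_STFT_le_frequency g φ (2 * N)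
  refine ⟨√(A * B), by positivity, fun x ξ => ?_⟩
  have hj : ∀ y : EuclideanSpace ℝ (Fin n), jp (-((2 * N : ℕ) : ℝ)) y = jp (-N) y ^ 2 := by
    intro y
    rw [sq, ← jp_add]
    congr 1
    push_cast
    ring
  have hx := jp_pos (-N : ℝ) x
  have hξ := jp_pos (-N : ℝ) ξ
  refine le_of_sq_le_sq ?_ (by positivity)
  calc ‖STFT g φ x ξ‖ ^ 2 ≤ (A * jp (-N) x ^ 2) * (B * jp (-N) ξ ^ 2) := by
        rw [sq, ← hj, ← hj]
        exact mul_le_mul ((norm_STFT_le _ _ _ _).trans (h1 x)) (h2 x ξ) (norm_nonneg _)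
          (mul_pos hA (jp_pos _ _)).le
    _ = (√(A * B) * (jp (-N) x * jp (-N) ξ)) ^ 2 := by
        rw [mul_pow, Real.sq_sqrt (by positivity)]
        ring

lemma norm_STFT_translate (g φ : EuclideanSpace ℝ (Fin n) → ℂ)
    (x ξ a : EuclideanSpace ℝ (Fin n)) :
    ‖STFT g (fun t => φ (t - a)) x ξ‖ = ‖STFT g φ (x - a) ξ‖ := by
  unfold STFT
  rw [← integral_add_right_eq_self _ a]
  have : ∀ t : EuclideanSpace ℝ (Fin n), Complex.exp (-(Complex.I * Complex.ofReal ⟪ξ, t + a⟫)) *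
      (starRingEnd ℂ) (g (t + a - x)) * φ (t + a - a) =
      Complex.exp (↑(-⟪ξ, a⟫) * Complex.I) *
      (Complex.exp (-(Complex.I * Complex.ofReal ⟪ξ, t⟫)) *
        (starRingEnd ℂ) (g (t - (x - a))) * φ t) := by
    intro t
    rw [← mul_assoc, ← mul_assoc, ← Complex.exp_add, inner_add_right, add_sub_cancel_right,
      sub_sub_eq_add_sub]
    congr 3
    push_cast
    ring
  simp_rw [this]
  rw [integral_const_mul, norm_mul, Complex.norm_exp_ofReal_mul_I, one_mul]

lemma norm_STFT_sum_le {ι : Type*} (S : Finset ι) (c : ι → ℂ) (a : ι → EuclideanSpace ℝ (Fin n))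
    (g φ : SchwartzMap (EuclideanSpace ℝ (Fin n)) ℂ) (x ξ : EuclideanSpace ℝ (Fin n)) :
    ‖STFT g (fun t => ∑ i ∈ S, c i * φ (t - a i)) x ξ‖ ≤
      ∑ i ∈ S, ‖c i‖ * ‖STFT g φ (x - a i) ξ‖ := by
  have hint : ∀ i ∈ S, Integrable fun t => c i *
      (Complex.exp (-(Complex.I * Complex.ofReal ⟪ξ, t⟫)) * (starRingEnd ℂ) (g (t - x)) *
        φ (t - a i)) := by
    intro i _
    refine Integrable.const_mul ?_ _
    have h := (integrable_STFT g φ (x - a i) ξ).comp_sub_right (a i)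
    refine (h.const_mul (Complex.exp (-(Complex.I * Complex.ofReal ⟪ξ, a i⟫)))).congr
      (.of_forall fun t => ?_)
    simp only
    rw [← mul_assoc, ← mul_assoc, ← Complex.exp_add, inner_sub_right, sub_sub_sub_cancel_right]
    congr 3
    push_cast
    ring
  have : STFT g (fun t => ∑ i ∈ S, c i * φ (t - a i)) x ξ =
      ∑ i ∈ S, c i * STFT g (fun t => φ (t - a i)) x ξ := by
    unfold STFT
    simp_rw [← integral_const_mul]
    rw [← integral_finsetSum S hint]
    refine integral_congr_ae (.of_forall fun t => ?_)
    simp only [Finset.mul_sum]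
    exact Finset.sum_congr rfl fun i _ => by ring
  rw [this]
  refine (norm_sum_le _ _).trans_eq (Finset.sum_congr rfl fun i _ => ?_)
  rw [norm_mul, norm_STFT_translate]

lemma one_le_dist_zlift {k l : Fin n → ℤ} (h : k ≠ l) : 1 ≤ dist (zlift k) (zlift l) := by
  obtain ⟨i, hi⟩ := Function.ne_iff.mp h
  rw [dist_eq_norm]
  refine le_trans ?_ (PiLp.norm_apply_le (zlift k - zlift l) i)
  have h1 : (1 : ℝ) ≤ ((|k i - l i| : ℤ) : ℝ) := by
    exact_mod_cast Int.one_le_abs (sub_ne_zero.mpr hi)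
  simpa [zlift] using h1

lemma exists_sum_jp_sub_zlift_le (n : ℕ) :
    ∃ W : ℝ≥0∞, W ≠ ∞ ∧ ∀ (S : Finset (Fin n → ℤ)) (x : EuclideanSpace ℝ (Fin n)),
      ∑ l ∈ S, ENNReal.ofReal (jp (-((n : ℝ) + 1)) (x - zlift l)) ≤ W := by
  set r : ℝ := (n : ℝ) + 1 with hr
  set w : EuclideanSpace ℝ (Fin n) → ℝ≥0∞ := fun y => ENNReal.ofReal (jp (-r) y) with hw
  have hI : ∫⁻ y, w y < ∞ := (integrable_jp (by linarith)).lintegral_lt_top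
  set b : ℝ≥0∞ := volume (Metric.ball (0 : EuclideanSpace ℝ (Fin n)) (1 / 2)) with hb
  have hb0 : b ≠ 0 := (Metric.measure_ball_pos _ _ (by norm_num)).ne'
  have hbt : b ≠ ∞ := measure_ball_lt_top.ne
  set D : ℝ := 2 ^ (r / 2) * 2 ^ (n + 1) with hD
  have hmeas : Measurable w := (continuous_jp (-r)).measurable.ennreal_ofReal
  have hloc : ∀ x y t : EuclideanSpace ℝ (Fin n), t ∈ Metric.ball y (1 / 2) →
      w (x - y) ≤ ENNReal.ofReal D * w (x - t) := by
    intro x y t ht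
    rw [hw, ← ENNReal.ofReal_mul (by positivity)]
    refine ENNReal.ofReal_le_ofReal ((jp_le_mul_jp_sub (-r) (x - y) (x - t)).trans ?_)
    have h1 : jp r (t - y) ≤ 2 ^ (n + 1) := by
      have h2 := jp_natCast_le (n + 1) (t - y)
      have h3 : ‖t - y‖ < 1 / 2 := by rwa [← dist_eq_norm]
      have h4 : ((n + 1 : ℕ) : ℝ) = r := by rw [hr]; push_cast; rfl
      rw [h4] at h2
      exact h2.trans (pow_le_pow_left₀ (by positivity) (by linarith) _)
    rw [abs_neg, abs_of_nonneg (by positivity), sub_sub_sub_cancel_left, hD, mul_assoc,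
      mul_comm (2 ^ (n + 1))]
    have := jp_pos (-r) (x - t)
    gcongr
  refine ⟨ENNReal.ofReal D * (∫⁻ y, w y) / b, ENNReal.div_ne_top
    (ENNReal.mul_ne_top ENNReal.ofReal_ne_top hI.ne) hb0, fun S x => ?_⟩
  rw [ENNReal.le_div_iff_mul_le (.inl hb0) (.inl hbt), Finset.sum_mul]
  calc ∑ l ∈ S, w (x - zlift l) * b
      ≤ ∑ l ∈ S, ∫⁻ t in Metric.ball (zlift l) (1 / 2), ENNReal.ofReal D * w (x - t) := by
        refine Finset.sum_le_sum fun l _ => ?_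
        rw [hb, ← Measure.addHaar_ball_center volume (zlift l), ← setLIntegral_const]
        exact setLIntegral_mono (by fun_prop) fun t ht => hloc x (zlift l) t ht
    _ = ∫⁻ t in ⋃ l ∈ S, Metric.ball (zlift l) (1 / 2), ENNReal.ofReal D * w (x - t) := by
        refine (lintegral_biUnion_finset (fun k _ l _ hkl => ?_)
          (fun _ _ => measurableSet_ball) _).symm
        exact Metric.ball_disjoint_ball (by linarith [one_le_dist_zlift hkl])
    _ ≤ ∫⁻ t, ENNReal.ofReal D * w (x - t) := setLIntegral_le_lintegral _ _
    _ = ENNReal.ofReal D * ∫⁻ y, w y := by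
        rw [lintegral_const_mul' _ _ ENNReal.ofReal_ne_top, lintegral_sub_left_eq_self w x]

lemma lpN_mono (p : ℝ≥0∞) {F G : EuclideanSpace ℝ (Fin n) → ℝ≥0∞} (h : ∀ x, F x ≤ G x) :
    lpN p F ≤ lpN p G := by
  unfold lpN
  split_ifs
  · exact essSup_mono_ae (.of_forall h)
  · refine ENNReal.rpow_le_rpow (lintegral_mono fun x => ?_) (by positivity)
    exact ENNReal.rpow_le_rpow (h x) ENNReal.toReal_nonneg

lemma lpN_const_mul {p : ℝ≥0∞} (hp : 1 ≤ p) {a : ℝ≥0∞} (ha : a ≠ ∞)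
    (F : EuclideanSpace ℝ (Fin n) → ℝ≥0∞) : lpN p (fun x => a * F x) = a * lpN p F := by
  unfold lpN
  split_ifs with h
  · exact ENNReal.essSup_const_mul
  · have h0 : 0 < p.toReal := ENNReal.toReal_pos (by positivity) h
    simp_rw [ENNReal.mul_rpow_of_nonneg _ _ h0.le]
    rw [lintegral_const_mul' _ _ (ENNReal.rpow_ne_top_of_nonneg h0.le ha),
      ENNReal.mul_rpow_of_nonneg _ _ (by positivity), ENNReal.rpow_rpow_inv h0.ne']

/-- The `ℓ^q` norm of an `ℝ≥0∞`-valued family. -/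
def sequenceNorm {ι : Type*} (q : ℝ≥0∞) (a : ι → ℝ≥0∞) : ℝ≥0∞ :=
  if q = ∞ then ⨆ i, a i else (∑' i, a i ^ q.toReal) ^ q.toReal⁻¹

lemma exists_lpN_sum_translates_le {q : ℝ≥0∞} (hq : 1 ≤ q) :
    ∃ K : ℝ≥0∞, K ≠ ∞ ∧ ∀ (S : Finset (Fin n → ℤ)) (a : (Fin n → ℤ) → ℝ≥0∞),
      lpN q (fun x : EuclideanSpace ℝ (Fin n) =>
        ∑ l ∈ S, ENNReal.ofReal (jp (-((n : ℝ) + 1)) (x - zlift l)) * a l) ≤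
        K * sequenceNorm q a := by
  obtain ⟨W, hW, hsum⟩ := exists_sum_jp_sub_zlift_le n
  by_cases hqt : q = ∞
  · refine ⟨W, hW, fun S a => ?_⟩
    simp only [lpN, sequenceNorm, if_pos hqt]
    refine essSup_le_of_ae_le _ (.of_forall fun x => ?_)
    calc _ ≤ ∑ l ∈ S, ENNReal.ofReal (jp (-((n : ℝ) + 1)) (x - zlift l)) * ⨆ i, a i :=
          Finset.sum_le_sum fun l _ => mul_le_mul_right (le_iSup a l) _
      _ ≤ _ := by
          rw [← Finset.sum_mul]
          exact mul_le_mul_left (hsum S x) _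
  · have hq1 : 1 ≤ q.toReal := by
      simpa using (ENNReal.toReal_le_toReal ENNReal.one_ne_top hqt).mpr hq
    have hq0 : 0 < q.toReal := by linarith
    set r := q.toReal with hr
    set w : EuclideanSpace ℝ (Fin n) → ℝ≥0∞ := fun y => ENNReal.ofReal (jp (-((n : ℝ) + 1)) y)
      with hw
    have hI : ∫⁻ y, w y < ∞ := (integrable_jp (by linarith)).lintegral_lt_top
    have hmeas : Measurable w := (continuous_jp _).measurable.ennreal_ofReal
    have hexp : 0 ≤ 1 - r⁻¹ := by linarith [inv_le_one_of_one_le₀ hq1]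
    have hWe : W ^ (1 - r⁻¹) ≠ ∞ := ENNReal.rpow_ne_top_of_nonneg hexp hW
    refine ⟨W ^ (1 - r⁻¹) * (∫⁻ y, w y) ^ r⁻¹, ENNReal.mul_ne_top hWe
      (ENNReal.rpow_ne_top_of_nonneg (by positivity) hI.ne), fun S a => ?_⟩
    have hpt : ∀ x : EuclideanSpace ℝ (Fin n), (∑ l ∈ S, w (x - zlift l) * a l) ^ r ≤
        (W ^ (1 - r⁻¹)) ^ r * ∑ l ∈ S, w (x - zlift l) * a l ^ r := by
      intro x
      calc _ ≤ (W ^ (1 - r⁻¹) * (∑ l ∈ S, w (x - zlift l) * a l ^ r) ^ r⁻¹) ^ r := by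
            refine ENNReal.rpow_le_rpow ((ENNReal.inner_le_weight_mul_Lp_of_nonneg S hq1
              (fun l => w (x - zlift l)) a).trans ?_) hq0.le
            exact mul_le_mul_left (ENNReal.rpow_le_rpow (hsum S x) hexp) _
        _ = _ := by rw [ENNReal.mul_rpow_of_nonneg _ _ hq0.le, ENNReal.rpow_inv_rpow hq0.ne']
    simp only [lpN, sequenceNorm, if_neg hqt, ← hr]
    calc _ ≤ ((W ^ (1 - r⁻¹)) ^ r * ((∫⁻ y, w y) * ∑' l, a l ^ r)) ^ r⁻¹ := by
          refine ENNReal.rpow_le_rpow ((lintegral_mono hpt).trans ?_) (by positivity)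
          rw [lintegral_const_mul' _ _ (ENNReal.rpow_ne_top_of_nonneg hq0.le hWe),
            lintegral_finsetSum _ fun l _ => by fun_prop]
          refine mul_le_mul_right ?_ _
          calc _ = ∑ l ∈ S, (∫⁻ y, w y) * a l ^ r := by
                refine Finset.sum_congr rfl fun l _ => ?_
                rw [lintegral_mul_const _ (by fun_prop), lintegral_sub_right_eq_self w]
            _ ≤ _ := by
                rw [← Finset.mul_sum]
                exact mul_le_mul_right (ENNReal.sum_le_tsum S) _
      _ = _ := by
          rw [ENNReal.mul_rpow_of_nonneg _ _ (by positivity), ENNReal.rpow_rpow_inv hq0.ne',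
            ENNReal.mul_rpow_of_nonneg _ _ (by positivity), mul_assoc]

lemma lpN_jp_ne_top {p : ℝ≥0∞} (hp : 1 ≤ p) :
    lpN p (fun ξ : EuclideanSpace ℝ (Fin n) => ENNReal.ofReal (jp (-((n : ℝ) + 1)) ξ)) ≠ ∞ := by
  have h1 : ∀ ξ : EuclideanSpace ℝ (Fin n), ENNReal.ofReal (jp (-((n : ℝ) + 1)) ξ) ≤ 1 :=
    fun ξ => ENNReal.ofReal_le_one.mpr (jp_le_one (by linarith [n.cast_nonneg (α := ℝ)]) ξ)
  unfold lpN
  split_ifs with h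
  · exact ne_top_of_le_ne_top ENNReal.one_ne_top (essSup_le_of_ae_le _ (.of_forall h1))
  · have hp1 : 1 ≤ p.toReal := by
      simpa using (ENNReal.toReal_le_toReal ENNReal.one_ne_top h).mpr hp
    refine ENNReal.rpow_ne_top_of_nonneg (by positivity) ?_
    refine ne_top_of_le_ne_top
      (integrable_jp (n := n) (r := (n : ℝ) + 1) (by linarith)).lintegral_lt_top.ne
      (lintegral_mono fun ξ => ?_)
    exact (ENNReal.rpow_le_rpow_of_exponent_ge (h1 ξ) hp1).trans_eq (ENNReal.rpow_one _)

lemma exists_weighted_STFT_sum_le (s : ℝ) (g φ : SchwartzMap (EuclideanSpace ℝ (Fin n)) ℂ) :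
    ∃ A : ℝ, 0 < A ∧ ∀ (c : (Fin n → ℤ) →₀ ℂ) (x ξ : EuclideanSpace ℝ (Fin n)),
      ENNReal.ofReal (jp s x) *
          (‖STFT g (fun t => ∑ l ∈ c.support, c l * φ (t - zlift l)) x ξ‖₊ : ℝ≥0∞) ≤
        ENNReal.ofReal (A * jp (-((n : ℝ) + 1)) ξ) *
          ∑ l ∈ c.support, ENNReal.ofReal (jp (-((n : ℝ) + 1)) (x - zlift l)) *
            (ENNReal.ofReal (jp s (zlift l)) * (‖c l‖₊ : ℝ≥0∞)) := by
  obtain ⟨N, hN⟩ := exists_nat_ge (|s| + (n + 1))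
  obtain ⟨B, hB, h⟩ := exists_norm_STFT_le g φ N
  refine ⟨B * 2 ^ (|s| / 2), by positivity, fun c x ξ => ?_⟩
  have hnn : ∀ z : ℂ, (‖z‖₊ : ℝ≥0∞) = ENNReal.ofReal ‖z‖ := fun z => by
    rw [ofReal_norm, enorm_eq_nnnorm]
  have hjp : ∀ (r : ℝ) (y : EuclideanSpace ℝ (Fin n)), 0 ≤ jp r y := fun r y => (jp_pos r y).le
  simp_rw [hnn, ← ENNReal.ofReal_mul (hjp _ _)]
  rw [← ENNReal.ofReal_sum_of_nonneg fun l _ => mul_nonneg (hjp _ _)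
      (mul_nonneg (hjp _ _) (norm_nonneg _)),
    ← ENNReal.ofReal_mul (mul_nonneg (by positivity) (hjp _ _))]
  refine ENNReal.ofReal_le_ofReal ?_
  rw [Finset.mul_sum]
  refine (mul_le_mul_of_nonneg_left (norm_STFT_sum_le _ _ _ g φ x ξ) (hjp _ _)).trans ?_
  rw [Finset.mul_sum]
  refine Finset.sum_le_sum fun l _ => ?_
  set y := x - zlift l with hy
  have h1 : jp (-(N : ℝ)) ξ ≤ jp (-((n : ℝ) + 1)) ξ := jp_mono (by linarith [abs_nonneg s]) ξ
  have h2 : jp |s| y * jp (-(N : ℝ)) y ≤ jp (-((n : ℝ) + 1)) y := by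
    rw [← jp_add]
    exact jp_mono (by linarith) y
  calc jp s x * (‖c l‖ * ‖STFT g φ y ξ‖)
      ≤ (2 ^ (|s| / 2) * (jp s (zlift l) * jp |s| y)) *
        (‖c l‖ * (B * (jp (-N) y * jp (-N) ξ))) := by
        have := hjp |s| y
        have := hjp s (zlift l)
        refine mul_le_mul (jp_le_mul_jp_sub s x (zlift l))
          (mul_le_mul_of_nonneg_left (h y ξ) (norm_nonneg _)) (by positivity) (by positivity)
    _ = (B * 2 ^ (|s| / 2)) * (jp s (zlift l) * ‖c l‖) *
        ((jp |s| y * jp (-N) y) * jp (-N) ξ) := by ring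
    _ ≤ (B * 2 ^ (|s| / 2)) * (jp s (zlift l) * ‖c l‖) *
        (jp (-((n : ℝ) + 1)) y * jp (-((n : ℝ) + 1)) ξ) := by
        have := hjp s (zlift l)
        refine mul_le_mul_of_nonneg_left ?_ (by positivity)
        exact mul_le_mul h2 h1 (hjp _ _) (hjp _ _)
    _ = _ := by ring

end helpers

/-- Step 2 of the key lemma: upper bound of the mixed norm `M^{(s,0)}_{q,p}` of
`f = Σ_ℓ c_ℓ φ(· - ℓ)` (inner `L^q` norm in `x` with weight `⟨x⟩^s`, outer `L^p` norm in `ξ`)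
by the weighted `ℓ^q` norm `(Σ_ℓ ⟨ℓ⟩^{sq} |c_ℓ|^q)^{1/q}` of the coefficients
(with the usual modification when `q = ∞`). -/
theorem mixed_norm_upper_bound (n : ℕ) (hn : 1 ≤ n) (s : ℝ) (p q : ℝ≥0∞)
    (hp : 1 ≤ p) (hq : 1 ≤ q)
    (g φ : SchwartzMap (EuclideanSpace ℝ (Fin n)) ℂ) (hg : g ≠ 0) :
    ∃ C : ℝ, 0 < C ∧ ∀ c : (Fin n → ℤ) →₀ ℂ,
      lpN p (fun ξ => lpN q (fun x =>
          ENNReal.ofReal (jp s x) *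
            (‖STFT ⇑g (fun t => ∑ ℓ ∈ c.support, c ℓ * φ (t - zlift ℓ)) x ξ‖₊ : ℝ≥0∞)))
        ≤ ENNReal.ofReal C *
          (if q = ∞ then
            ⨆ ℓ : Fin n → ℤ, ENNReal.ofReal (jp s (zlift ℓ)) * (‖c ℓ‖₊ : ℝ≥0∞)
          else
            (∑' ℓ : Fin n → ℤ,
              (ENNReal.ofReal (jp s (zlift ℓ)) * (‖c ℓ‖₊ : ℝ≥0∞)) ^ q.toReal) ^ q.toReal⁻¹) := by
  obtain ⟨A, hA, hpt⟩ := exists_weighted_STFT_sum_le s g φ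
  obtain ⟨K, hK, hsum⟩ := exists_lpN_sum_translates_le (n := n) hq
  set P := lpN p (fun ξ : EuclideanSpace ℝ (Fin n) => ENNReal.ofReal (jp (-((n : ℝ) + 1)) ξ))
    with hP
  have hPt : P ≠ ∞ := lpN_jp_ne_top hp
  set T : ℝ≥0∞ := K * ENNReal.ofReal A * P with hT
  have hTt : T ≠ ∞ := ENNReal.mul_ne_top (ENNReal.mul_ne_top hK ENNReal.ofReal_ne_top) hPt
  refine ⟨T.toReal + 1, by positivity, fun c => ?_⟩
  set R := sequenceNorm q fun ℓ => ENNReal.ofReal (jp s (zlift ℓ)) * (‖c ℓ‖₊ : ℝ≥0∞) with hR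
  change _ ≤ ENNReal.ofReal (T.toReal + 1) * R
  by_cases hRt : R = ∞
  · rw [hRt, ENNReal.mul_top (ENNReal.ofReal_pos.mpr (by positivity)).ne']
    exact le_top
  have hinner : ∀ ξ : EuclideanSpace ℝ (Fin n), lpN q (fun x => ENNReal.ofReal (jp s x) *
      (‖STFT ⇑g (fun t => ∑ ℓ ∈ c.support, c ℓ * φ (t - zlift ℓ)) x ξ‖₊ : ℝ≥0∞)) ≤
      (K * ENNReal.ofReal A * R) * ENNReal.ofReal (jp (-((n : ℝ) + 1)) ξ) := by
    intro ξ
    refine (lpN_mono q fun x => hpt c x ξ).trans ?_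
    rw [lpN_const_mul hq ENNReal.ofReal_ne_top]
    refine (mul_le_mul_right (hsum c.support _) _).trans_eq ?_
    rw [ENNReal.ofReal_mul hA.le]
    ring
  refine (lpN_mono p hinner).trans ?_
  rw [lpN_const_mul hp (ENNReal.mul_ne_top (ENNReal.mul_ne_top hK ENNReal.ofReal_ne_top) hRt)]
  calc K * ENNReal.ofReal A * R * P = T * R := by rw [hT]; ring
    _ ≤ _ := by
      refine mul_le_mul_left ?_ _
      rw [← ENNReal.ofReal_toReal hTt]
      exact ENNReal.ofReal_le_ofReal (by simp)

end
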